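/- Let Ω ⊂ ℝⁿ be a bounded domain. Then Ω is a QH-visibility domain if and only if for every pair of distinct points p, q ∈ ∂Ω and all sequences z_k → p and w_k → q in Ω, one has limsup_{k→∞} (z_k | w_k)_o < ∞ for some (equivalently, every) base point o ∈ Ω, where (x|y)_o = ½(k_Ω(x,o) + k_Ω(o,y) − k_Ω(x,y)) is the Gromov product with respect to the quasihyperbolic metric. -/

import Mathlib

open Metric Set Filter Topology MeasureTheory
open scoped NNReal ENNReal

noncomputable section

variable {E : Type*} [NormedAddCommGroup E] [NormedSpace ℝ E]

/-- The quasihyperbolic length of a path `γ : [a, b] → Ω`, i.e. `∫ ‖γ'(t)‖ / δ_Ω(γ t) dt`. -/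
def qhLength (Ω : Set E) (γ : ℝ → E) (a b : ℝ) : ℝ :=
  ∫ t in a..b, ‖deriv γ t‖ / infDist (γ t) Ωᶜ

/-- Admissible (Lipschitz, i.e. rectifiable) paths joining `x` to `y` inside `Ω`. -/
def qhAdmissible (Ω : Set E) (x y : E) (γ : ℝ → E) (a b : ℝ) : Prop :=
  a ≤ b ∧ γ a = x ∧ γ b = y ∧ (∀ t ∈ Icc a b, γ t ∈ Ω) ∧
    ∃ K : ℝ≥0, LipschitzOnWith K γ (Icc a b)

/-- The quasihyperbolic distance `k_Ω` on a domain `Ω`. -/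
def qhDist (Ω : Set E) (x y : E) : ℝ :=
  sInf { L : ℝ | ∃ γ a b, qhAdmissible Ω x y γ a b ∧ L = qhLength Ω γ a b }

/-- `γ` is a (unit-speed) quasihyperbolic geodesic on the parameter set `s`. -/
def IsQHGeodesicOn (Ω : Set E) (γ : ℝ → E) (s : Set ℝ) : Prop :=
  (∀ t ∈ s, γ t ∈ Ω) ∧ ∀ a ∈ s, ∀ b ∈ s, qhDist Ω (γ a) (γ b) = |a - b|

/-- `Ω` is a QH-visibility domain: any two distinct Euclidean boundary points have
neighbourhoods with disjoint closures together with a compact subset of `Ω` which is met by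
every quasihyperbolic geodesic joining the two neighbourhoods. -/
def QHVisibilityDomain (Ω : Set E) : Prop :=
  ∀ p ∈ frontier Ω, ∀ q ∈ frontier Ω, p ≠ q →
    ∃ U V : Set E, IsOpen U ∧ IsOpen V ∧ p ∈ U ∧ q ∈ V ∧
      closure U ∩ closure V = ∅ ∧
      ∃ K : Set E, IsCompact K ∧ K ⊆ Ω ∧
        ∀ (γ : ℝ → E) (T : ℝ), 0 ≤ T → IsQHGeodesicOn Ω γ (Icc 0 T) →
          γ 0 ∈ U → γ T ∈ V → ∃ t ∈ Icc 0 T, γ t ∈ K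

/-- The Gromov product with respect to the quasihyperbolic distance. -/
def qhGromovProd (Ω : Set E) (o x y : E) : ℝ :=
  (qhDist Ω x o + qhDist Ω o y - qhDist Ω x y) / 2

/-- `(Ω, k_Ω)` is Gromov hyperbolic (four-point condition on the Gromov product). -/
def QHGromovHyperbolic (Ω : Set E) : Prop :=
  ∃ δ : ℝ, 0 ≤ δ ∧ ∀ o ∈ Ω, ∀ x ∈ Ω, ∀ y ∈ Ω, ∀ z ∈ Ω,
    min (qhGromovProd Ω o x y) (qhGromovProd Ω o y z) - δ ≤ qhGromovProd Ω o x z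

theorem infDist_compl_pos {X : Type*} [NormedAddCommGroup X] {Ω : Set X} (hO : IsOpen Ω)
    (hC : Ωᶜ.Nonempty) {x : X} (hx : x ∈ Ω) :
    0 < infDist x Ωᶜ :=
  (hO.isClosed_compl.notMem_iff_infDist_pos hC).1 (by simpa using hx)

namespace qhAdmissible

theorem intervalIntegrable [FiniteDimensional ℝ E] {Ω : Set E} (hO : IsOpen Ω)
    (hC : Ωᶜ.Nonempty) {x y : E} {γ : ℝ → E} {a b : ℝ} (h : qhAdmissible Ω x y γ a b) :
    IntervalIntegrable (fun t => ‖deriv γ t‖ / infDist (γ t) Ωᶜ) volume a b := by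
  obtain ⟨hab, -, -, hΩ, K, hK⟩ := h
  have := FiniteDimensional.complete ℝ E
  simp only [div_eq_mul_inv]
  refine IntervalIntegrable.mul_continuousOn ?_ ?_
  · rw [intervalIntegrable_iff_integrableOn_Ioo_of_le hab]
    refine Measure.integrableOn_of_bounded (M := K) (by simp)
      (stronglyMeasurable_deriv γ).norm.aestronglyMeasurable ?_
    filter_upwards [self_mem_ae_restrict measurableSet_Ioo] with t ht
    simpa using norm_deriv_le_of_lipschitzOn (Icc_mem_nhds ht.1 ht.2) hK
  · rw [uIcc_of_le hab]
    exact ((continuous_infDist_pt _).comp_continuousOn hK.continuousOn).inv₀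
      fun t ht => (infDist_compl_pos hO hC (hΩ t ht)).ne'

theorem restrict {X : Type*} [NormedAddCommGroup X] {Ω : Set X} {x y : X} {γ : ℝ → X} {a b s t : ℝ}
    (h : qhAdmissible Ω x y γ a b)
    (has : a ≤ s) (hst : s ≤ t) (htb : t ≤ b) : qhAdmissible Ω (γ s) (γ t) γ s t := by
  obtain ⟨-, -, -, hΩ, K, hK⟩ := h
  have hsub : Icc s t ⊆ Icc a b := Icc_subset_Icc has htb
  exact ⟨hst, rfl, rfl, fun u hu => hΩ u (hsub hu), K, hK.mono hsub⟩

theorem symm {X : Type*} [NormedAddCommGroup X] {Ω : Set X} {x y : X} {γ : ℝ → X} {a b : ℝ}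
    (h : qhAdmissible Ω x y γ a b) :
    qhAdmissible Ω y x (fun t => γ (-t)) (-b) (-a) := by
  obtain ⟨hab, hx, hy, hΩ, K, hK⟩ := h
  refine ⟨by linarith, by simpa, by simpa, fun t ht => hΩ _ ⟨?_, ?_⟩, K, ?_⟩
  · linarith [ht.2]
  · linarith [ht.1]
  · refine LipschitzOnWith.of_dist_le_mul fun s hs t ht => ?_
    have := hK.dist_le_mul (-s) ⟨by linarith [hs.2], by linarith [hs.1]⟩ (-t)
      ⟨by linarith [ht.2], by linarith [ht.1]⟩
    simpa using this

end qhAdmissible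

theorem qhLength_comp_neg (Ω : Set E) (γ : ℝ → E) (a b : ℝ) :
    qhLength Ω (fun t => γ (-t)) (-b) (-a) = qhLength Ω γ a b := by
  unfold qhLength
  simp only [deriv_comp_neg, norm_neg]
  rw [intervalIntegral.integral_comp_neg (fun t => ‖deriv γ t‖ / infDist (γ t) Ωᶜ)]
  simp

theorem qhLength_comp_sub (Ω : Set E) (γ : ℝ → E) (a b c : ℝ) :
    qhLength Ω (fun t => γ (t - c)) a b = qhLength Ω γ (a - c) (b - c) := by
  unfold qhLength
  simp only [deriv_comp_sub_const]
  rw [intervalIntegral.integral_comp_sub_right (fun t => ‖deriv γ t‖ / infDist (γ t) Ωᶜ)]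

theorem qhLength_congr {Ω : Set E} {γ η : ℝ → E} {a b : ℝ} (hab : a ≤ b)
    (h : EqOn γ η (Ioo a b)) : qhLength Ω γ a b = qhLength Ω η a b := by
  refine intervalIntegral.integral_congr_Ioo_of_le hab fun t ht => ?_
  have h' : γ =ᶠ[𝓝 t] η := by
    filter_upwards [Ioo_mem_nhds ht.1 ht.2] with s hs using h hs
  simp only [h'.deriv_eq, h ht]

theorem qhLength_nonneg (Ω : Set E) (γ : ℝ → E) {a b : ℝ} (hab : a ≤ b) :
    0 ≤ qhLength Ω γ a b :=
  intervalIntegral.integral_nonneg hab fun _ _ => div_nonneg (norm_nonneg _) infDist_nonneg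

theorem LipschitzOnWith.Icc_union {X : Type*} [NormedAddCommGroup X] {γ : ℝ → X} {K L : ℝ≥0}
    {a b c : ℝ}
    (hab : LipschitzOnWith K γ (Icc a b)) (hbc : LipschitzOnWith L γ (Icc b c))
    (h₁ : a ≤ b) (h₂ : b ≤ c) : LipschitzOnWith (max K L) γ (Icc a c) := by
  have hab' := hab.weaken (le_max_left K L)
  have hbc' := hbc.weaken (le_max_right K L)
  have key : ∀ s ∈ Icc a c, ∀ t ∈ Icc a c, s ≤ t →
      dist (γ s) (γ t) ≤ (max K L : ℝ≥0) * dist s t := by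
    intro s hs t ht hst
    rcases le_total t b with htb | htb
    · exact hab'.dist_le_mul s ⟨hs.1, hst.trans htb⟩ t ⟨ht.1, htb⟩
    rcases le_total b s with hbs | hbs
    · exact hbc'.dist_le_mul s ⟨hbs, hs.2⟩ t ⟨htb, ht.2⟩
    have e₁ := hab'.dist_le_mul s ⟨hs.1, hbs⟩ b ⟨h₁, le_rfl⟩
    have e₂ := hbc'.dist_le_mul b ⟨le_rfl, h₂⟩ t ⟨htb, ht.2⟩
    calc dist (γ s) (γ t) ≤ dist (γ s) (γ b) + dist (γ b) (γ t) := dist_triangle _ _ _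
      _ ≤ (max K L : ℝ≥0) * dist s b + (max K L : ℝ≥0) * dist b t := add_le_add e₁ e₂
      _ = (max K L : ℝ≥0) * dist s t := by
        rw [← mul_add, Real.dist_eq, Real.dist_eq, Real.dist_eq, abs_of_nonpos (by linarith),
          abs_of_nonpos (by linarith), abs_of_nonpos (by linarith)]
        ring
  refine LipschitzOnWith.of_dist_le_mul fun s hs t ht => ?_
  rcases le_total s t with hst | hst
  · exact key s hs t ht hst
  · rw [dist_comm, dist_comm s]
    exact key t ht s hs hst

theorem qhAdmissible.exists_trans [FiniteDimensional ℝ E] {Ω : Set E} (hO : IsOpen Ω)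
    (hC : Ωᶜ.Nonempty) {x y z : E} {γ η : ℝ → E} {a b c d : ℝ}
    (h : qhAdmissible Ω x y γ a b) (h' : qhAdmissible Ω y z η c d) :
    ∃ ζ e, qhAdmissible Ω x z ζ a e ∧ qhLength Ω ζ a e = qhLength Ω γ a b + qhLength Ω η c d := by
  obtain ⟨hab, hx, hy, hΩ, K, hK⟩ := h
  obtain ⟨hcd, hy', hz, hΩ', L, hL⟩ := h'
  set ζ : ℝ → E := fun t => if t ≤ b then γ t else η (t - (b - c)) with hζ
  have hbe : b ≤ d + (b - c) := by linarith
  have hleft : EqOn ζ γ (Icc a b) := fun t ht => if_pos ht.2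
  have hright : EqOn ζ (fun t => η (t - (b - c))) (Icc b (d + (b - c))) := by
    intro t ht
    rcases ht.1.eq_or_lt with rfl | hlt
    · simp [hζ, hy, hy']
    · exact if_neg hlt.not_ge
  have hmem : ∀ t ∈ Icc b (d + (b - c)), t - (b - c) ∈ Icc c d :=
    fun t ht => ⟨by linarith [ht.1], by linarith [ht.2]⟩
  have hKζ : LipschitzOnWith K ζ (Icc a b) := fun s hs t ht => by
    rw [hleft hs, hleft ht]; exact hK hs ht
  have hLζ : LipschitzOnWith L ζ (Icc b (d + (b - c))) := fun s hs t ht => by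
    rw [hright hs, hright ht]
    simpa using hL (hmem s hs) (hmem t ht)
  have hadm : qhAdmissible Ω x z ζ a (d + (b - c)) := by
    refine ⟨hab.trans hbe, ?_, ?_, fun t ht => ?_, _, hKζ.Icc_union hLζ hab hbe⟩
    · rw [hleft ⟨le_rfl, hab⟩, hx]
    · rw [hright ⟨hbe, le_rfl⟩]
      simpa using hz
    · rcases le_total t b with htb | htb
      · rw [hleft ⟨ht.1, htb⟩]; exact hΩ t ⟨ht.1, htb⟩
      · rw [hright ⟨htb, ht.2⟩]; exact hΩ' _ (hmem t ⟨htb, ht.2⟩)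
  refine ⟨ζ, _, hadm, ?_⟩
  have e₁ : qhLength Ω ζ a b = qhLength Ω γ a b :=
    qhLength_congr hab (hleft.mono Ioo_subset_Icc_self)
  have e₂ : qhLength Ω ζ b (d + (b - c)) = qhLength Ω η c d := by
    rw [qhLength_congr hbe (hright.mono Ioo_subset_Icc_self), qhLength_comp_sub]
    congr 1 <;> ring
  rw [← e₁, ← e₂]
  exact (intervalIntegral.integral_add_adjacent_intervals
    ((hadm.restrict le_rfl hab hbe).intervalIntegrable hO hC)
    ((hadm.restrict hab hbe le_rfl).intervalIntegrable hO hC)).symm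

theorem exists_qhAdmissible_of_ball_subset {Ω : Set E} {x y : E} {r : ℝ} (hr : 0 < r)
    (hxy : dist y x < r) (hball : ∀ u ∈ ball x r, u ∈ Ω ∧ r ≤ infDist u Ωᶜ) :
    ∃ γ a b, qhAdmissible Ω x y γ a b ∧ qhLength Ω γ a b ≤ dist y x / r := by
  have hderiv : ∀ t : ℝ, HasDerivAt (fun t : ℝ => x + t • (y - x)) (y - x) t := fun t => by
    simpa using ((hasDerivAt_id t).smul_const (y - x)).const_add x
  have hmem : ∀ t ∈ Icc (0 : ℝ) 1, x + t • (y - x) ∈ ball x r := fun t ht => by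
    rw [mem_ball, dist_eq_norm, add_sub_cancel_left, norm_smul, Real.norm_of_nonneg ht.1,
      ← dist_eq_norm]
    exact (mul_le_of_le_one_left dist_nonneg ht.2).trans_lt hxy
  refine ⟨fun t => x + t • (y - x), 0, 1, ⟨zero_le_one, by simp, by simp,
    fun t ht => (hball _ (hmem t ht)).1, ‖y - x‖₊, ?_⟩, ?_⟩
  · refine LipschitzOnWith.of_dist_le_mul fun s _ t _ => ?_
    rw [dist_add_left, dist_eq_norm, ← sub_smul, norm_smul, mul_comm, coe_nnnorm,
      Real.dist_eq, Real.norm_eq_abs]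
  · have hle : ∀ t ∈ Set.uIoc (0 : ℝ) 1,
        ‖‖deriv (fun t : ℝ => x + t • (y - x)) t‖ / infDist (x + t • (y - x)) Ωᶜ‖
          ≤ dist y x / r := by
      intro t ht
      rw [uIoc_of_le zero_le_one] at ht
      rw [Real.norm_of_nonneg (div_nonneg (norm_nonneg _) infDist_nonneg), (hderiv t).deriv,
        dist_eq_norm]
      exact div_le_div_of_nonneg_left (norm_nonneg _) hr
        (hball _ (hmem t (Ioc_subset_Icc_self ht))).2
    have := intervalIntegral.norm_integral_le_of_norm_le_const hle
    simp only [sub_zero, abs_one, mul_one] at this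
    exact (le_abs_self _).trans this

theorem infDist_compl_ball {X : Type*} [NormedAddCommGroup X] {Ω : Set X} {x : X} {r : ℝ}
    (hr : 0 < r)
    (h : 2 * r ≤ infDist x Ωᶜ) : ∀ u ∈ ball x r, u ∈ Ω ∧ r ≤ infDist u Ωᶜ := by
  intro u hu
  have h₁ : infDist x Ωᶜ ≤ infDist u Ωᶜ + dist x u := infDist_le_infDist_add_dist
  rw [mem_ball'] at hu
  refine ⟨?_, by linarith⟩
  by_contra hn
  have : infDist u Ωᶜ = 0 := infDist_zero_of_mem hn
  linarith

section qhDist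

theorem qhDist_le_qhLength {Ω : Set E} {x y : E} {γ : ℝ → E} {a b : ℝ}
    (h : qhAdmissible Ω x y γ a b) : qhDist Ω x y ≤ qhLength Ω γ a b := by
  refine csInf_le ⟨0, ?_⟩ ⟨γ, a, b, h, rfl⟩
  rintro _ ⟨η, c, d, hη, rfl⟩
  exact qhLength_nonneg Ω η hη.1

theorem qhDist_nonneg (Ω : Set E) (x y : E) : 0 ≤ qhDist Ω x y := by
  refine Real.sInf_nonneg ?_
  rintro _ ⟨η, c, d, hη, rfl⟩
  exact qhLength_nonneg Ω η hη.1

theorem qhDist_comm (Ω : Set E) (x y : E) : qhDist Ω x y = qhDist Ω y x := by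
  have key : ∀ x y : E, { L : ℝ | ∃ γ a b, qhAdmissible Ω x y γ a b ∧ L = qhLength Ω γ a b } ⊆
      { L : ℝ | ∃ γ a b, qhAdmissible Ω y x γ a b ∧ L = qhLength Ω γ a b } := by
    rintro x y _ ⟨γ, a, b, h, rfl⟩
    exact ⟨_, _, _, h.symm, (qhLength_comp_neg Ω γ a b).symm⟩
  exact congrArg sInf ((key x y).antisymm (key y x))

theorem qhDist_le_of_ball_subset {Ω : Set E} {x y : E} {r : ℝ} (hr : 0 < r)
    (hx : 2 * r ≤ infDist x Ωᶜ) (hxy : dist y x < r) : qhDist Ω x y ≤ dist y x / r := by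
  obtain ⟨γ, a, b, h, hl⟩ := exists_qhAdmissible_of_ball_subset hr hxy (infDist_compl_ball hr hx)
  exact (qhDist_le_qhLength h).trans hl

theorem tendsto_qhDist_zero {Ω : Set E} (hO : IsOpen Ω) (hC : Ωᶜ.Nonempty) {x : E} (hx : x ∈ Ω) :
    Tendsto (fun y => qhDist Ω x y) (𝓝 x) (𝓝 0) := by
  have hpos := half_pos (infDist_compl_pos hO hC hx)
  have hlim : Tendsto (fun y => dist y x / (infDist x Ωᶜ / 2)) (𝓝 x) (𝓝 0) := by
    have : Continuous fun y => dist y x / (infDist x Ωᶜ / 2) := by fun_prop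
    simpa using this.tendsto x
  refine tendsto_of_tendsto_of_tendsto_of_le_of_le' tendsto_const_nhds hlim
    (Eventually.of_forall fun y => qhDist_nonneg Ω x y) ?_
  filter_upwards [ball_mem_nhds x hpos] with y hy
  exact qhDist_le_of_ball_subset hpos (by linarith) hy

theorem norm_deriv_comp_le {γ : ℝ → E} {t : ℝ} (hγ : DifferentiableAt ℝ γ t) {F : E → ℝ}
    (hF : LipschitzWith 1 F) : ‖deriv (fun s => F (γ s)) t‖ ≤ ‖deriv γ t‖ := by
  refine le_of_forall_pos_le_add fun ε hε => ?_
  refine norm_deriv_le_of_lip' (by positivity) ?_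
  have h := hγ.hasDerivAt.isLittleO.def hε
  filter_upwards [h] with s hs
  have h₁ : ‖F (γ s) - F (γ t)‖ ≤ ‖γ s - γ t‖ := by
    simpa [dist_eq_norm] using hF.dist_le_mul (γ s) (γ t)
  have h₂ : ‖γ s - γ t‖ ≤ ‖γ s - γ t - (s - t) • deriv γ t‖ + ‖(s - t) • deriv γ t‖ := by
    simpa using norm_add_le (γ s - γ t - (s - t) • deriv γ t) ((s - t) • deriv γ t)
  rw [norm_smul] at h₂
  linarith

variable [FiniteDimensional ℝ E] {Ω : Set E}

theorem exists_qhAdmissible (hO : IsOpen Ω) (hC : Ωᶜ.Nonempty) (hΩ : IsPreconnected Ω) {x y : E}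
    (hx : x ∈ Ω) (hy : y ∈ Ω) : ∃ γ a b, qhAdmissible Ω x y γ a b := by
  refine hΩ.induction₂ (fun x y => ∃ γ a b, qhAdmissible Ω x y γ a b) (fun x hx => ?_) ?_ ?_ hx hy
  · have hpos := infDist_compl_pos hO hC hx
    filter_upwards [mem_nhdsWithin_of_mem_nhds (ball_mem_nhds x (half_pos hpos))] with y hy
    obtain ⟨γ, a, b, h, -⟩ := exists_qhAdmissible_of_ball_subset (half_pos hpos) hy
      (infDist_compl_ball (Ω := Ω) (half_pos hpos) (by linarith))
    exact ⟨γ, a, b, h⟩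
  · rintro x y z - - - ⟨γ, a, b, h⟩ ⟨η, c, d, h'⟩
    obtain ⟨ζ, e, hζ, -⟩ := h.exists_trans hO hC h'
    exact ⟨ζ, a, e, hζ⟩
  · rintro x y - - ⟨γ, a, b, h⟩
    exact ⟨_, _, _, h.symm⟩

theorem exists_qhLength_lt (hO : IsOpen Ω) (hC : Ωᶜ.Nonempty) (hΩ : IsPreconnected Ω) {x y : E}
    (hx : x ∈ Ω) (hy : y ∈ Ω) {ε : ℝ} (hε : 0 < ε) :
    ∃ γ a b, qhAdmissible Ω x y γ a b ∧ qhLength Ω γ a b < qhDist Ω x y + ε := by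
  obtain ⟨γ, a, b, h⟩ := exists_qhAdmissible hO hC hΩ hx hy
  obtain ⟨_, ⟨η, c, d, hη, rfl⟩, hlt⟩ := exists_lt_of_csInf_lt
    (s := { L : ℝ | ∃ γ a b, qhAdmissible Ω x y γ a b ∧ L = qhLength Ω γ a b })
    ⟨_, γ, a, b, h, rfl⟩ (lt_add_of_pos_right (qhDist Ω x y) hε)
  exact ⟨η, c, d, hη, hlt⟩

theorem qhDist_triangle (hO : IsOpen Ω) (hC : Ωᶜ.Nonempty) (hΩ : IsPreconnected Ω) {x y z : E}
    (hx : x ∈ Ω) (hy : y ∈ Ω) (hz : z ∈ Ω) : qhDist Ω x z ≤ qhDist Ω x y + qhDist Ω y z := by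
  refine le_of_forall_pos_le_add fun ε hε => ?_
  obtain ⟨γ, a, b, h, hl⟩ := exists_qhLength_lt hO hC hΩ hx hy (half_pos hε)
  obtain ⟨η, c, d, h', hl'⟩ := exists_qhLength_lt hO hC hΩ hy hz (half_pos hε)
  obtain ⟨ζ, e, hζ, hlζ⟩ := h.exists_trans hO hC h'
  linarith [qhDist_le_qhLength hζ]

theorem tendsto_qhDist (hO : IsOpen Ω) (hC : Ωᶜ.Nonempty) (hΩ : IsPreconnected Ω)
    {ι : Type*} {l : Filter ι} {u v : ι → E} {x y : E} (hx : x ∈ Ω) (hy : y ∈ Ω)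
    (hu : Tendsto u l (𝓝 x)) (hv : Tendsto v l (𝓝 y)) :
    Tendsto (fun i => qhDist Ω (u i) (v i)) l (𝓝 (qhDist Ω x y)) := by
  have h₁ := (tendsto_qhDist_zero hO hC hx).comp hu
  have h₂ := (tendsto_qhDist_zero hO hC hy).comp hv
  have h₃ : Tendsto (fun i => qhDist Ω x (u i) + qhDist Ω y (v i)) l (𝓝 0) := by
    simpa using h₁.add h₂
  rw [tendsto_iff_dist_tendsto_zero]
  refine squeeze_zero' (Eventually.of_forall fun _ => dist_nonneg) ?_ h₃
  filter_upwards [hu.eventually (hO.mem_nhds hx), hv.eventually (hO.mem_nhds hy)] with i hui hvi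
  have e₁ := qhDist_triangle hO hC hΩ hui hx hvi
  have e₂ := qhDist_triangle hO hC hΩ hx hy hvi
  have e₃ := qhDist_triangle hO hC hΩ hx hui hy
  have e₄ := qhDist_triangle hO hC hΩ hui hvi hy
  rw [qhDist_comm Ω (u i) x] at e₁
  rw [qhDist_comm Ω (v i) y] at e₄
  rw [Real.dist_eq, abs_le]
  constructor <;> linarith

theorem qhAdmissible.sub_le_mul_qhLength (hO : IsOpen Ω) (hC : Ωᶜ.Nonempty) {x y : E}
    {γ : ℝ → E} {a b : ℝ} (h : qhAdmissible Ω x y γ a b) {g : ℝ → ℝ} {L : ℝ≥0} {C : ℝ}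
    (hg : LipschitzOnWith L g (Icc a b))
    (hle : ∀ᵐ t, t ∈ Ioo a b → deriv g t ≤ C * (‖deriv γ t‖ / infDist (γ t) Ωᶜ)) :
    g b - g a ≤ C * qhLength Ω γ a b := by
  have hac : AbsolutelyContinuousOnInterval g a b :=
    LipschitzOnWith.absolutelyContinuousOnInterval (by rwa [uIcc_of_le h.1])
  rw [← hac.integral_deriv_eq_sub, qhLength, ← intervalIntegral.integral_const_mul]
  refine intervalIntegral.integral_mono_ae_restrict h.1 hac.intervalIntegrable_deriv
    ((h.intervalIntegrable hO hC).const_mul C) ?_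
  rw [← restrict_Ioo_eq_restrict_Icc]
  exact (ae_restrict_iff' measurableSet_Ioo).2 hle

theorem qhAdmissible.ae_differentiableAt {x y : E} {γ : ℝ → E} {a b : ℝ}
    (h : qhAdmissible Ω x y γ a b) : ∀ᵐ t, t ∈ Ioo a b → DifferentiableAt ℝ γ t := by
  obtain ⟨-, -, -, -, K, hK⟩ := h
  filter_upwards [hK.ae_differentiableWithinAt_of_mem_real] with t ht hmem
  exact (ht (Ioo_subset_Icc_self hmem)).differentiableAt (Icc_mem_nhds hmem.1 hmem.2)

theorem qhAdmissible.dist_le_mul_qhLength (hO : IsOpen Ω) (hC : Ωᶜ.Nonempty) {x y : E}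
    {γ : ℝ → E} {a b : ℝ} (h : qhAdmissible Ω x y γ a b) {D : ℝ}
    (hD : ∀ u ∈ Ω, infDist u Ωᶜ ≤ D) : dist y x ≤ D * qhLength Ω γ a b := by
  have hF : LipschitzWith 1 fun u : E => dist u x := LipschitzWith.dist_left x
  have hae := h.ae_differentiableAt
  obtain ⟨hab, hxa, hyb, hγ, K, hK⟩ := id h
  have key := h.sub_le_mul_qhLength hO hC (C := D) (hF.comp_lipschitzOnWith hK) <| by
    filter_upwards [hae] with t ht hmem
    have hmem' := hγ t (Ioo_subset_Icc_self hmem)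
    have hpos := infDist_compl_pos hO hC hmem'
    calc deriv (fun s => dist (γ s) x) t ≤ ‖deriv γ t‖ :=
          (le_abs_self _).trans (norm_deriv_comp_le (ht hmem) hF)
      _ = infDist (γ t) Ωᶜ * (‖deriv γ t‖ / infDist (γ t) Ωᶜ) := by field_simp
      _ ≤ D * (‖deriv γ t‖ / infDist (γ t) Ωᶜ) :=
          mul_le_mul_of_nonneg_right (hD _ hmem') (by positivity)
  simpa [hxa, hyb] using key

theorem qhAdmissible.log_infDist_sub_le (hO : IsOpen Ω) (hC : Ωᶜ.Nonempty) {x y : E}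
    {γ : ℝ → E} {a b : ℝ} (h : qhAdmissible Ω x y γ a b) :
    Real.log (infDist y Ωᶜ) - Real.log (infDist x Ωᶜ) ≤ qhLength Ω γ a b := by
  have hF : LipschitzWith 1 fun u : E => infDist u Ωᶜ := lipschitz_infDist_pt _
  have hae := h.ae_differentiableAt
  obtain ⟨hab, hxa, hyb, hγ, K, hK⟩ := id h
  have hd : LipschitzOnWith (1 * K) (fun t => infDist (γ t) Ωᶜ) (Icc a b) :=
    hF.comp_lipschitzOnWith hK
  obtain ⟨t₀, ht₀, hmin⟩ := isCompact_Icc.exists_isMinOn ⟨a, le_rfl, hab⟩ hd.continuousOn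
  have hm := infDist_compl_pos hO hC (hγ t₀ ht₀)
  set m := infDist (γ t₀) Ωᶜ with hm_def
  have hpos : ∀ t ∈ Icc a b, m ≤ infDist (γ t) Ωᶜ := fun t ht => hmin ht
  have hlog : LipschitzOnWith (Real.toNNReal m⁻¹) Real.log (Ici m) := by
    refine (convex_Ici m).lipschitzOnWith_of_nnnorm_deriv_le (fun u hu => ?_) fun u hu => ?_
    · exact Real.differentiableAt_log (hm.trans_le hu).ne'
    · rw [← NNReal.coe_le_coe, coe_nnnorm, Real.deriv_log, Real.coe_toNNReal _ (by positivity),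
        Real.norm_of_nonneg (inv_nonneg.2 (hm.le.trans hu))]
      exact inv_anti₀ hm hu
  have key := h.sub_le_mul_qhLength hO hC (C := 1) (hlog.comp hd hpos) <| by
    filter_upwards [hae, hd.ae_differentiableWithinAt_of_mem_real] with t ht hdt hmem
    have hmem' := Ioo_subset_Icc_self hmem
    have hpos' := infDist_compl_pos hO hC (hγ t hmem')
    have hdt' := (hdt hmem').differentiableAt (Icc_mem_nhds hmem.1 hmem.2)
    change deriv (fun s => Real.log (infDist (γ s) Ωᶜ)) t ≤ _
    rw [deriv.log hdt' hpos'.ne', one_mul]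
    gcongr
    exact (le_abs_self _).trans (norm_deriv_comp_le (ht hmem) hF)
  simpa [hxa, hyb] using key

theorem dist_le_mul_qhDist (hO : IsOpen Ω) (hC : Ωᶜ.Nonempty) (hΩ : IsPreconnected Ω) {D : ℝ}
    (hD : ∀ u ∈ Ω, infDist u Ωᶜ ≤ D) {x y : E} (hx : x ∈ Ω) (hy : y ∈ Ω) :
    dist y x ≤ D * qhDist Ω x y := by
  have hD0 : 0 ≤ D := infDist_nonneg.trans (hD x hx)
  have hlim : Tendsto (fun ε => D * (qhDist Ω x y + ε)) (𝓝[>] 0) (𝓝 (D * (qhDist Ω x y + 0))) :=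
    (Continuous.tendsto (by fun_prop) 0).mono_left nhdsWithin_le_nhds
  rw [add_zero] at hlim
  refine ge_of_tendsto hlim ?_
  filter_upwards [self_mem_nhdsWithin] with ε hε
  obtain ⟨γ, a, b, h, hl⟩ := exists_qhLength_lt hO hC hΩ hx hy hε
  exact (h.dist_le_mul_qhLength hO hC hD).trans (mul_le_mul_of_nonneg_left hl.le hD0)

theorem infDist_mul_exp_neg_le (hO : IsOpen Ω) (hC : Ωᶜ.Nonempty) (hΩ : IsPreconnected Ω)
    {x y : E} (hx : x ∈ Ω) (hy : y ∈ Ω) :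
    infDist x Ωᶜ * Real.exp (-qhDist Ω x y) ≤ infDist y Ωᶜ := by
  have h : Real.log (infDist x Ωᶜ) - Real.log (infDist y Ωᶜ) ≤ qhDist Ω x y := by
    rw [qhDist_comm]
    refine le_of_forall_pos_le_add fun ε hε => ?_
    obtain ⟨γ, a, b, h, hl⟩ := exists_qhLength_lt hO hC hΩ hy hx hε
    exact (h.log_infDist_sub_le hO hC).trans hl.le
  have hx' := infDist_compl_pos hO hC hx
  have hy' := infDist_compl_pos hO hC hy
  calc infDist x Ωᶜ * Real.exp (-qhDist Ω x y)
      = Real.exp (Real.log (infDist x Ωᶜ) - qhDist Ω x y) := by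
        rw [sub_eq_add_neg, Real.exp_add, Real.exp_log hx']
    _ ≤ Real.exp (Real.log (infDist y Ωᶜ)) := Real.exp_le_exp.2 (by linarith)
    _ = infDist y Ωᶜ := Real.exp_log hy'

theorem exists_infDist_compl_le {X : Type*} [NormedAddCommGroup X] {Ω : Set X} (hC : Ωᶜ.Nonempty)
    (hB : Bornology.IsBounded Ω) :
    ∃ D, ∀ u ∈ Ω, infDist u Ωᶜ ≤ D := by
  obtain ⟨c, hc⟩ := hC
  obtain ⟨D, hD⟩ := hB.subset_closedBall c
  exact ⟨D, fun u hu => (infDist_le_dist_of_mem hc).trans (hD hu)⟩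

theorem isCompact_setOf_le_infDist_compl (hB : Bornology.IsBounded Ω) {r : ℝ} (hr : 0 < r) :
    IsCompact {x | r ≤ infDist x Ωᶜ} := by
  have := FiniteDimensional.proper_real E
  refine isCompact_of_isClosed_isBounded
    (isClosed_le continuous_const (continuous_infDist_pt _)) (hB.subset fun x hx => ?_)
  by_contra hn
  have h₀ : infDist x Ωᶜ = 0 := infDist_zero_of_mem hn
  have h₁ : r ≤ infDist x Ωᶜ := hx
  linarith

/-- The quasihyperbolic metric of a bounded domain is geodesic. -/
theorem exists_isQHGeodesicOn (hO : IsOpen Ω) (hC : Ωᶜ.Nonempty) (hΩ : IsPreconnected Ω)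
    (hB : Bornology.IsBounded Ω) {x y : E} (hx : x ∈ Ω) (hy : y ∈ Ω) :
    ∃ γ : ℝ → E, IsQHGeodesicOn Ω γ (Icc 0 (qhDist Ω x y)) ∧ γ 0 = x ∧
      γ (qhDist Ω x y) = y := by
  set T := qhDist Ω x y with hT
  have hT0 : 0 ≤ T := qhDist_nonneg Ω x y
  have happrox : ∀ n : ℕ, ∃ σ : ℝ → E, (∀ s ∈ Icc 0 T, σ s ∈ Ω) ∧
      (∀ s ∈ Icc 0 T, ∀ t ∈ Icc 0 T, s ≤ t → qhDist Ω (σ s) (σ t) ≤ t - s) ∧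
      (∀ s ∈ Icc 0 T, qhDist Ω x (σ s) ≤ s) ∧ qhDist Ω (σ T) y ≤ 1 / ((n : ℝ) + 1) := by
    intro n
    obtain ⟨η, a, b, h, hl⟩ := exists_qhLength_lt hO hC hΩ hx hy (Nat.one_div_pos_of_nat (n := n))
    have hTl : T ≤ qhLength Ω η a b := qhDist_le_qhLength h
    have hcont : ContinuousOn (fun t => qhLength Ω η a t) (Icc a b) := by
      have := intervalIntegral.continuousOn_primitive_interval'
        (h.intervalIntegrable hO hC) left_mem_uIcc
      rwa [uIcc_of_le h.1] at this
    have hsurj : ∀ s ∈ Icc 0 T, ∃ t ∈ Icc a b, qhLength Ω η a t = s := fun s hs => by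
      refine intermediate_value_Icc h.1 hcont ⟨?_, hs.2.trans hTl⟩
      simpa [qhLength] using hs.1
    have hadd : ∀ s ∈ Icc a b, ∀ t ∈ Icc a b, s ≤ t →
        qhDist Ω (η s) (η t) ≤ qhLength Ω η a t - qhLength Ω η a s := fun s hs t ht hst => by
      have e := intervalIntegral.integral_add_adjacent_intervals
        ((h.restrict le_rfl hs.1 hs.2).intervalIntegrable hO hC)
        ((h.restrict hs.1 hst ht.2).intervalIntegrable hO hC)
      have e' := qhDist_le_qhLength (h.restrict hs.1 hst ht.2)
      unfold qhLength at *
      linarith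
    have hmono : ∀ s ∈ Icc a b, ∀ t ∈ Icc a b, s ≤ t → qhLength Ω η a s ≤ qhLength Ω η a t :=
      fun s hs t ht hst => by linarith [hadd s hs t ht hst, qhDist_nonneg Ω (η s) (η t)]
    have hdist : ∀ s ∈ Icc a b, ∀ t ∈ Icc a b, qhLength Ω η a s ≤ qhLength Ω η a t →
        qhDist Ω (η s) (η t) ≤ qhLength Ω η a t - qhLength Ω η a s := fun s hs t ht hst => by
      rcases le_total s t with h' | h'
      · exact hadd s hs t ht h'
      · rw [qhDist_comm]
        linarith [hadd t ht s hs h', hmono t ht s hs h']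
    choose! τ hτ hτl using hsurj
    refine ⟨fun s => η (τ s), fun s hs => h.2.2.2.1 _ (hτ s hs), fun s hs t ht hst => ?_,
      fun s hs => ?_, ?_⟩
    · have := hdist _ (hτ s hs) _ (hτ t ht) (by rwa [hτl s hs, hτl t ht])
      rwa [hτl s hs, hτl t ht] at this
    · have := hadd a ⟨le_rfl, h.1⟩ _ (hτ s hs) (hτ s hs).1
      rwa [hτl s hs, h.2.1, qhLength, intervalIntegral.integral_same, sub_zero] at this
    · have hTm : T ∈ Icc 0 T := ⟨hT0, le_rfl⟩
      have := hadd _ (hτ T hTm) b ⟨h.1, le_rfl⟩ (hτ T hTm).2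
      rw [hτl T hTm, h.2.2.1] at this
      linarith
  choose σ hσΩ hσ hσ0 hσT using happrox
  set r := infDist x Ωᶜ * Real.exp (-T) with hr_def
  have hr : 0 < r := mul_pos (infDist_compl_pos hO hC hx) (Real.exp_pos _)
  have hK := isCompact_setOf_le_infDist_compl hB hr
  set l : Ultrafilter ℕ := Ultrafilter.of atTop
  have hlat : (l : Filter ℕ) ≤ atTop := Ultrafilter.of_le _
  have hlim : ∀ s ∈ Icc 0 T, ∃ u ∈ Ω, Tendsto (fun n => σ n s) l (𝓝 u) := by
    intro s hs
    obtain ⟨u, hu, hlu⟩ := hK.ultrafilter_le_nhds (l.map fun n => σ n s) <| by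
      refine le_principal_iff.2 (Eventually.of_forall fun n => ?_ :
        ∀ᶠ n in (l : Filter ℕ), σ n s ∈ {x | r ≤ infDist x Ωᶜ})
      refine le_trans ?_ (infDist_mul_exp_neg_le hO hC hΩ hx (hσΩ n s hs))
      rw [hr_def]
      gcongr
      · exact infDist_nonneg
      · exact (hσ0 n s hs).trans hs.2
    refine ⟨u, ?_, hlu⟩
    by_contra hn
    exact absurd (hr.trans_le hu) (infDist_zero_of_mem hn : infDist u Ωᶜ = 0).not_gt
  choose! γ hγΩ hγ using hlim
  have h0 : (0 : ℝ) ∈ Icc 0 T := ⟨le_rfl, hT0⟩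
  have hTm : T ∈ Icc 0 T := ⟨hT0, le_rfl⟩
  obtain ⟨D, hD⟩ := exists_infDist_compl_le hC hB
  have heq : ∀ u ∈ Ω, ∀ v ∈ Ω, qhDist Ω u v ≤ 0 → v = u := fun u hu v hv huv => by
    have h₁ := dist_le_mul_qhDist hO hC hΩ hD hu hv
    rw [huv.antisymm (qhDist_nonneg Ω u v), mul_zero] at h₁
    exact dist_le_zero.1 h₁
  have hγ0 : γ 0 = x := heq x hx _ (hγΩ 0 h0) <|
    le_of_tendsto (tendsto_qhDist hO hC hΩ hx (hγΩ 0 h0) tendsto_const_nhds (hγ 0 h0))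
      (Eventually.of_forall fun n => hσ0 n 0 h0)
  have hγT : γ T = y := (heq _ (hγΩ T hTm) y hy <|
    le_of_tendsto_of_tendsto'
      (tendsto_qhDist hO hC hΩ (hγΩ T hTm) hy (hγ T hTm) tendsto_const_nhds)
      (tendsto_one_div_add_atTop_nhds_zero_nat.mono_left hlat) fun n => hσT n).symm
  have hle : ∀ s ∈ Icc 0 T, ∀ t ∈ Icc 0 T, s ≤ t → qhDist Ω (γ s) (γ t) ≤ t - s :=
    fun s hs t ht hst => le_of_tendsto
      (tendsto_qhDist hO hC hΩ (hγΩ s hs) (hγΩ t ht) (hγ s hs) (hγ t ht))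
      (Eventually.of_forall fun n => hσ n s hs t ht hst)
  have hle' : ∀ s ∈ Icc 0 T, ∀ t ∈ Icc 0 T, s ≤ t → qhDist Ω (γ s) (γ t) = t - s := by
    intro s hs t ht hst
    refine (hle s hs t ht hst).antisymm ?_
    have e₁ := hle 0 h0 s hs hs.1
    have e₂ := hle t ht T hTm ht.2
    have e₃ := qhDist_triangle hO hC hΩ (hγΩ 0 h0) (hγΩ s hs) (hγΩ t ht)
    have e₄ := qhDist_triangle hO hC hΩ (hγΩ 0 h0) (hγΩ t ht) (hγΩ T hTm)
    rw [hγT, hγ0, ← hT] at e₄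
    rw [hγ0] at e₁ e₃
    rw [hγT] at e₂
    linarith
  refine ⟨γ, ⟨hγΩ, fun s hs t ht => ?_⟩, hγ0, hγT⟩
  rcases le_total s t with hst | hst
  · rw [hle' s hs t ht hst, abs_of_nonpos (by linarith)]
    ring
  · rw [qhDist_comm, hle' t ht s hs hst, abs_of_nonneg (by linarith)]

end qhDist

section Visibility

theorem IsQHGeodesicOn.qhDist_add {Ω : Set E} {γ : ℝ → E} {T t : ℝ}
    (h : IsQHGeodesicOn Ω γ (Icc 0 T))
    (ht : t ∈ Icc 0 T) :
    qhDist Ω (γ 0) (γ T) = qhDist Ω (γ 0) (γ t) + qhDist Ω (γ t) (γ T) := by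
  have h0 : (0 : ℝ) ∈ Icc 0 T := ⟨le_rfl, ht.1.trans ht.2⟩
  have hT : T ∈ Icc 0 T := ⟨ht.1.trans ht.2, le_rfl⟩
  rw [h.2 _ h0 _ hT, h.2 _ h0 _ ht, h.2 _ ht _ hT, abs_of_nonpos (by linarith [h0.2]),
    abs_of_nonpos (by linarith [ht.1]), abs_of_nonpos (by linarith [ht.2])]
  ring

variable [FiniteDimensional ℝ E] {Ω : Set E}

theorem qhGromovProd_le_qhDist (hO : IsOpen Ω) (hC : Ωᶜ.Nonempty) (hΩ : IsPreconnected Ω)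
    {o x y c : E} (ho : o ∈ Ω) (hx : x ∈ Ω) (hy : y ∈ Ω) (hc : c ∈ Ω)
    (h : qhDist Ω x y = qhDist Ω x c + qhDist Ω c y) : qhGromovProd Ω o x y ≤ qhDist Ω o c := by
  have e₁ := qhDist_triangle hO hC hΩ hx hc ho
  have e₂ := qhDist_triangle hO hC hΩ ho hc hy
  rw [qhDist_comm Ω c o] at e₁
  unfold qhGromovProd
  linarith

theorem qhDist_le_qhGromovProd_add (hO : IsOpen Ω) (hC : Ωᶜ.Nonempty) (hΩ : IsPreconnected Ω)
    {o x y c : E} (ho : o ∈ Ω) (hx : x ∈ Ω) (hy : y ∈ Ω)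
    (h : qhDist Ω x y = qhDist Ω x c + qhDist Ω c y) :
    qhDist Ω o c ≤ qhGromovProd Ω o x c + qhGromovProd Ω o c y := by
  have e := qhDist_triangle hO hC hΩ hx ho hy
  have e' := qhDist_comm Ω c o
  unfold qhGromovProd
  linarith

theorem disjoint_closure_ball {X : Type*} [NormedAddCommGroup X] {p q : X} {r s : ℝ}
    (h : r + s < dist p q) :
    closure (ball p r) ∩ closure (ball q s) = ∅ := by
  exact (Disjoint.mono closure_ball_subset_closedBall closure_ball_subset_closedBall
    (closedBall_disjoint_closedBall h)).inter_eq

theorem IsQHGeodesicOn.continuousOn (hO : IsOpen Ω) (hC : Ωᶜ.Nonempty) (hΩ : IsPreconnected Ω)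
    (hB : Bornology.IsBounded Ω) {γ : ℝ → E} {s : Set ℝ} (h : IsQHGeodesicOn Ω γ s) :
    ContinuousOn γ s := by
  obtain ⟨D, hD⟩ := exists_infDist_compl_le hC hB
  refine LipschitzOnWith.continuousOn (K := D.toNNReal) <|
    LipschitzOnWith.of_dist_le_mul fun u hu v hv => ?_
  have := dist_le_mul_qhDist hO hC hΩ hD (h.1 u hu) (h.1 v hv)
  rw [h.2 u hu v hv, dist_comm] at this
  rw [Real.dist_eq]
  exact this.trans (mul_le_mul_of_nonneg_right (Real.le_coe_toNNReal D) (abs_nonneg _))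

theorem QHVisibilityDomain.exists_qhGromovProd_le (hvis : QHVisibilityDomain Ω) (hO : IsOpen Ω)
    (hC : Ωᶜ.Nonempty) (hΩ : IsPreconnected Ω) (hB : Bornology.IsBounded Ω) {p q : E}
    (hp : p ∈ frontier Ω) (hq : q ∈ frontier Ω) (hpq : p ≠ q) {z w : ℕ → E}
    (hz : ∀ k, z k ∈ Ω) (hw : ∀ k, w k ∈ Ω) (hzp : Tendsto z atTop (𝓝 p))
    (hwq : Tendsto w atTop (𝓝 q)) {o : E} (ho : o ∈ Ω) :
    ∃ M : ℝ, ∀ k, qhGromovProd Ω o (z k) (w k) ≤ M := by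
  obtain ⟨U, V, hU, hV, hpU, hqV, -, K, hK, hKΩ, hKγ⟩ := hvis p hp q hq hpq
  have hcont : ContinuousOn (fun c => qhDist Ω o c) K := fun c hc =>
    tendsto_qhDist hO hC hΩ ho (hKΩ hc) tendsto_const_nhds
      (tendsto_id.mono_left nhdsWithin_le_nhds)
  obtain ⟨M, hM⟩ := hK.bddAbove_image hcont
  have hbdd : IsBoundedUnder (· ≤ ·) atTop fun k => qhGromovProd Ω o (z k) (w k) := by
    refine ⟨M, ?_⟩
    rw [eventually_map]
    filter_upwards [hzp.eventually (hU.mem_nhds hpU), hwq.eventually (hV.mem_nhds hqV)]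
      with k hzU hwV
    obtain ⟨γ, hγ, h0, hT⟩ := exists_isQHGeodesicOn hO hC hΩ hB (hz k) (hw k)
    obtain ⟨t, ht, htK⟩ := hKγ γ _ (qhDist_nonneg _ _ _) hγ (h0 ▸ hzU) (hT.symm ▸ hwV)
    have hadd := hγ.qhDist_add ht
    rw [h0, hT] at hadd
    exact (qhGromovProd_le_qhDist hO hC hΩ ho (hz k) (hw k) (hKΩ htK) hadd).trans
      (hM (mem_image_of_mem _ htK))
  obtain ⟨M', hM'⟩ := hbdd.bddAbove_range
  exact ⟨M', fun k => hM' (mem_range_self k)⟩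

theorem qhVisibilityDomain_of_exists_qhGromovProd_le (hO : IsOpen Ω) (hC : Ωᶜ.Nonempty)
    (hΩ : IsPreconnected Ω) (hB : Bornology.IsBounded Ω) {o : E} (ho : o ∈ Ω)
    (h : ∀ p ∈ frontier Ω, ∀ q ∈ frontier Ω, p ≠ q → ∀ z w : ℕ → E,
      (∀ k, z k ∈ Ω) → (∀ k, w k ∈ Ω) → Tendsto z atTop (𝓝 p) → Tendsto w atTop (𝓝 q) →
      ∃ M : ℝ, ∀ k, qhGromovProd Ω o (z k) (w k) ≤ M) :
    QHVisibilityDomain Ω := by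
  have := FiniteDimensional.proper_real E
  intro p hp q hq hpq
  by_contra! hcon
  set r := dist p q with hr_def
  have hr : 0 < r := dist_pos.2 hpq
  set ε : ℕ → ℝ := fun n => 1 / ((n : ℝ) + 1) with hε_def
  have hε : ∀ n, 0 < ε n := fun n => Nat.one_div_pos_of_nat
  have hε1 : ∀ n, ε n ≤ 1 := fun n => by
    rw [hε_def, div_le_one (by positivity)]
    linarith [Nat.cast_nonneg (α := ℝ) n]
  have hεlim : Tendsto ε atTop (𝓝 0) := tendsto_one_div_add_atTop_nhds_zero_nat
  have hρ : ∀ n, r / 3 * ε n ≤ r / 3 := fun n =>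
    mul_le_of_le_one_right (by positivity) (hε1 n)
  have hρlim : Tendsto (fun n => r / 3 * ε n) atTop (𝓝 0) := by
    simpa using hεlim.const_mul (r / 3)
  have hgeo : ∀ n, ∃ (γ : ℝ → E) (T : ℝ), 0 ≤ T ∧ IsQHGeodesicOn Ω γ (Icc 0 T) ∧
      γ 0 ∈ ball p (r / 3 * ε n) ∧ γ T ∈ ball q (r / 3 * ε n) ∧
      ∀ t ∈ Icc 0 T, γ t ∉ {x | ε n ≤ infDist x Ωᶜ} := fun n =>
    hcon _ _ isOpen_ball isOpen_ball (mem_ball_self (by have := hε n; positivity))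
      (mem_ball_self (by have := hε n; positivity))
      (disjoint_closure_ball (by linarith [hρ n])) _
      (isCompact_setOf_le_infDist_compl hB (hε n)) fun x hx => by
        by_contra hn
        exact absurd ((hε n).trans_le hx) (infDist_zero_of_mem hn : infDist x Ωᶜ = 0).not_gt
  choose γ T hT hγ hγp hγq hγK using hgeo
  have hmid : ∀ n, ∃ t ∈ Icc 0 (T n), dist (γ n t) p = r / 2 := fun n => by
    have hc : ContinuousOn (fun t => dist (γ n t) p) (Icc 0 (T n)) :=
      (continuous_id.dist continuous_const).comp_continuousOn
        ((hγ n).continuousOn hO hC hΩ hB)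
    refine intermediate_value_Icc (hT n) hc ⟨?_, ?_⟩
    · have := mem_ball.1 (hγp n)
      linarith [hρ n]
    · have h₁ := mem_ball.1 (hγq n)
      have h₂ := dist_triangle_left p q (γ n (T n))
      linarith [hρ n]
  choose t ht htp using hmid
  have hxΩ : ∀ n, γ n (t n) ∈ Ω := fun n => (hγ n).1 _ (ht n)
  have hzΩ : ∀ n, γ n 0 ∈ Ω := fun n => (hγ n).1 _ ⟨le_rfl, hT n⟩
  have hwΩ : ∀ n, γ n (T n) ∈ Ω := fun n => (hγ n).1 _ ⟨hT n, le_rfl⟩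
  obtain ⟨ξ, -, φ, hφ, hlim⟩ := tendsto_subseq_of_bounded hB hxΩ
  have hφlim := hφ.tendsto_atTop
  have hξp : dist ξ p = r / 2 :=
    tendsto_nhds_unique (hlim.dist tendsto_const_nhds)
      (by simp only [Function.comp_apply, htp]; exact tendsto_const_nhds)
  have hdlim : Tendsto (fun n => infDist (γ (φ n) (t (φ n))) Ωᶜ) atTop (𝓝 0) :=
    squeeze_zero (fun _ => infDist_nonneg) (fun n => (not_le.1 (hγK _ _ (ht _))).le)
      (hεlim.comp hφlim)
  have hξ : infDist ξ Ωᶜ = 0 :=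
    tendsto_nhds_unique (((continuous_infDist_pt _).tendsto ξ).comp hlim) hdlim
  have hξΩ : ξ ∉ Ω := fun hmem => (infDist_compl_pos hO hC hmem).ne' hξ
  have hξfr : ξ ∈ frontier Ω := by
    rw [hO.frontier_eq]
    exact ⟨mem_closure_of_tendsto hlim (Eventually.of_forall fun n => hxΩ _), hξΩ⟩
  have hpξ : p ≠ ξ := by
    rintro rfl
    rw [dist_self] at hξp
    linarith
  have hξq : ξ ≠ q := by
    rintro rfl
    rw [dist_comm] at hξp
    linarith
  have hzp : Tendsto (fun n => γ n 0) atTop (𝓝 p) := tendsto_iff_dist_tendsto_zero.2 <|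
    squeeze_zero (fun _ => dist_nonneg) (fun n => (mem_ball.1 (hγp n)).le) hρlim
  have hwq : Tendsto (fun n => γ n (T n)) atTop (𝓝 q) := tendsto_iff_dist_tendsto_zero.2 <|
    squeeze_zero (fun _ => dist_nonneg) (fun n => (mem_ball.1 (hγq n)).le) hρlim
  obtain ⟨M₁, hM₁⟩ := h p hp ξ hξfr hpξ _ _ (fun n => hzΩ (φ n)) (fun n => hxΩ (φ n))
    (hzp.comp hφlim) hlim
  obtain ⟨M₂, hM₂⟩ := h ξ hξfr q hq hξq _ _ (fun n => hxΩ (φ n)) (fun n => hwΩ (φ n))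
    hlim (hwq.comp hφlim)
  have hlow : ∀ n, infDist o Ωᶜ * Real.exp (-(M₁ + M₂)) ≤
      infDist (γ (φ n) (t (φ n))) Ωᶜ := fun n => by
    refine le_trans ?_ (infDist_mul_exp_neg_le hO hC hΩ ho (hxΩ (φ n)))
    gcongr
    · exact infDist_nonneg
    · exact (qhDist_le_qhGromovProd_add hO hC hΩ ho (hzΩ _) (hwΩ _)
        ((hγ (φ n)).qhDist_add (ht (φ n)))).trans (add_le_add (hM₁ n) (hM₂ n))
  have hpos := mul_pos (infDist_compl_pos hO hC ho) (Real.exp_pos (-(M₁ + M₂)))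
  exact absurd (ge_of_tendsto' hdlim hlow) hpos.not_ge

end Visibility

/-- A bounded domain `Ω ⊆ ℝⁿ` is a QH-visibility domain if and only if for
every pair of distinct boundary points `p ≠ q` and all sequences `z → p`, `w → q` in `Ω`,
the Gromov products `(z k | w k)_o` (w.r.t. the quasihyperbolic metric) stay bounded above,
for every base point `o ∈ Ω`. -/
theorem statement0 {n : ℕ} (Ω : Set (EuclideanSpace ℝ (Fin n)))
    (hOpen : IsOpen Ω) (hConn : IsConnected Ω) (hBdd : Bornology.IsBounded Ω) :
    QHVisibilityDomain Ω ↔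
      ∀ p ∈ frontier Ω, ∀ q ∈ frontier Ω, p ≠ q →
        ∀ z w : ℕ → EuclideanSpace ℝ (Fin n),
          (∀ k, z k ∈ Ω) → (∀ k, w k ∈ Ω) →
          Tendsto z atTop (𝓝 p) → Tendsto w atTop (𝓝 q) →
          ∀ o ∈ Ω, ∃ M : ℝ, ∀ k, qhGromovProd Ω o (z k) (w k) ≤ M := by
  have hC : ∀ p ∈ frontier Ω, Ωᶜ.Nonempty := fun p hp =>
    ⟨p, (hOpen.frontier_eq ▸ hp : p ∈ closure Ω \ Ω).2⟩
  constructor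
  · intro hvis p hp q hq hpq z w hz hw hzp hwq o ho
    exact hvis.exists_qhGromovProd_le hOpen (hC p hp) hConn.isPreconnected hBdd hp hq hpq hz hw
      hzp hwq ho
  · intro h p hp
    obtain ⟨o, ho⟩ := hConn.nonempty
    exact qhVisibilityDomain_of_exists_qhGromovProd_le hOpen (hC p hp) hConn.isPreconnected hBdd ho
      (fun p hp q hq hpq z w hz hw hzp hwq => h p hp q hq hpq z w hz hw hzp hwq o ho) p hp

end
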